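/- arXiv:2402.11965 — 3 statements merged into one kernel-verified Lean document; each statement's English description precedes it below -/
import Mathlib

section
/- Let m ≥ 3 be an integer and let f(z) = (m−1)/z − m·z^{m−1}/(z^m−1), a holomorphic function on the punctured disk 0 < |z| < 1. Then for every integer s with 3 ≤ s ≤ m and every ρ ∈ (0,1), ∮_{|z|=ρ} f(z)^s dz = 0; that is, the residue of f^s at 0 vanishes. (This expresses the vanishing R^{(r)}_{1,1} ≡ 0 for 1 ≤ r ≤ m−2 at the central neck of the Costa–Hoffman–Meeks configuration, where f dz = ω_2.) -/
theorem chm_central_residues_vanish (m : ℕ) (hm : 3 ≤ m) (s : ℕ) (hs1 : 3 ≤ s) (hs2 : s ≤ m)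
    (ρ : ℝ) (hρ : ρ ∈ Set.Ioo (0 : ℝ) 1) :
    (∮ z in C(0, ρ),
      (((m : ℂ) - 1) / z - (m : ℂ) * z ^ (m - 1) / (z ^ m - 1)) ^ s) = 0 := by
  obtain ⟨h0, h1⟩ := hρ
  let x : ℂ → ℂ := fun z => ((m : ℂ) - 1) - (m : ℂ) * z ^ m / (z ^ m - 1)
  let H : ℂ → ℂ := fun z => z ^ (m - s) * ((∑ i ∈ Finset.range s,
    x z ^ i * ((m : ℂ) - 1) ^ (s - 1 - i)) * (-(m : ℂ) / (z ^ m - 1)))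
  have hne : ∀ z : ℂ, ‖z‖ < 1 → z ^ m - 1 ≠ 0 := by
    intro z hz h
    have h2 : ‖z ^ m‖ = 1 := by rw [sub_eq_zero.mp h]; simp
    rw [norm_pow] at h2
    have := pow_lt_one₀ (norm_nonneg z) hz (show m ≠ 0 by omega)
    linarith
  have hH : ∀ z : ℂ, ‖z‖ < 1 → DifferentiableAt ℂ H z := by
    intro z hz
    have := hne z hz
    have hx : DifferentiableAt ℂ x z := by
      simp only [x]
      fun_prop (disch := assumption)
    simp only [H]
    fun_prop (disch := assumption)
  have hball : ∀ z ∈ Metric.closedBall (0 : ℂ) ρ, ‖z‖ < 1 := by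
    intro z hz
    rw [mem_closedBall_zero_iff] at hz
    linarith
  have hHc : ContinuousOn H (Metric.closedBall 0 ρ) := fun z hz =>
    (hH z (hball z hz)).continuousAt.continuousWithinAt
  have hI : (∮ z in C(0, ρ), H z) = 0 :=
    Complex.circleIntegral_eq_zero_of_differentiable_on_off_countable h0.le
      Set.countable_empty hHc
      (fun z hz => hH z (hball z (Metric.ball_subset_closedBall hz.1)))
  have hP : (∮ z in C(0, ρ), ((m : ℂ) - 1) ^ s * (z - 0) ^ (-(s : ℤ))) = 0 := by
    rw [circleIntegral.integral_const_mul,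
      circleIntegral.integral_sub_zpow_of_ne (by omega), mul_zero]
  have key : Set.EqOn
      (fun z : ℂ => (((m : ℂ) - 1) / z - (m : ℂ) * z ^ (m - 1) / (z ^ m - 1)) ^ s)
      (fun z => ((m : ℂ) - 1) ^ s * (z - 0) ^ (-(s : ℤ)) + H z) (Metric.sphere 0 ρ) := by
    intro z hz
    have hz1 := hne z (hball z (Metric.sphere_subset_closedBall hz))
    have hz0 : z ≠ 0 := by
      rintro rfl
      simp at hz
      linarith
    have e1 : ((m : ℂ) - 1) / z - (m : ℂ) * z ^ (m - 1) / (z ^ m - 1) = x z / z := by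
      have : z ^ m = z ^ (m - 1) * z := by rw [← pow_succ]; congr 1; omega
      simp only [x]
      rw [sub_div ((m : ℂ) - 1) ((m : ℂ) * z ^ m / (z ^ m - 1)) z]
      congr 1
      rw [eq_div_iff hz0, div_mul_eq_mul_div, mul_assoc, ← this]
    have e2 := geom_sum₂_mul (x z) ((m : ℂ) - 1) s
    have e3 : x z - ((m : ℂ) - 1) = z ^ m * (-(m : ℂ) / (z ^ m - 1)) := by
      simp only [x]; ring
    have e4 : z ^ m = z ^ (m - s) * z ^ s := by rw [← pow_add]; congr 1; omega
    have e5 : x z ^ s = ((m : ℂ) - 1) ^ s + H z * z ^ s := by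
      rw [e3] at e2
      have : H z * z ^ s = (∑ i ∈ Finset.range s, x z ^ i * ((m : ℂ) - 1) ^ (s - 1 - i)) *
          ((z ^ (m - s) * z ^ s) * (-(m : ℂ) / (z ^ m - 1))) := by
        simp only [H]; ring
      rw [this, ← e4, e2]; ring
    have hzs : z ^ s ≠ 0 := pow_ne_zero _ hz0
    simp only [sub_zero, zpow_neg, zpow_natCast]
    rw [e1, div_pow, e5]
    field_simp
  rw [circleIntegral.integral_congr h0.le key, circleIntegral.integral_add, hP, hI, add_zero]
  · refine ContinuousOn.circleIntegrable h0.le ?_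
    intro z hz
    have hz0 : z - 0 ≠ 0 := by
      intro h
      rw [sub_zero] at h
      subst h
      simp at hz
      linarith
    refine ContinuousAt.continuousWithinAt ?_
    exact continuousAt_const.mul ((continuousAt_id.sub continuousAt_const).zpow₀ _ (Or.inl hz0))
  · exact (hHc.mono Metric.sphere_subset_closedBall).circleIntegrable h0.le
end

section
/- Let m ≥ 2 be an integer and let f(z) = (m−1)/z − m·z^{m−1}/(z^m−1), a holomorphic function on the punctured disk 0 < |z| < 1. Then for every ρ ∈ (0,1), (1/(2πi))·∮_{|z|=ρ} f(z)^{m+1} dz = (m+1)·m·(m−1)^m; that is, the residue of f^{m+1} at 0 equals (m+1)·m·(m−1)^m. (For m = 2 this gives the residue 6 used in the Lorentzian Costa example.) -/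
/-- For `f(z) = (m−1)/z − m z^{m−1}/(z^m−1)`, the residue of `f^{m+1}` at `0`
equals `(m+1)·m·(m−1)^m`, the residue computed as a circle integral. -/
theorem chm_central_residue_top (m : ℕ) (hm : 2 ≤ m) (ρ : ℝ) (hρ : ρ ∈ Set.Ioo (0 : ℝ) 1) :
    (2 * (Real.pi : ℂ) * Complex.I)⁻¹ *
        (∮ z in C(0, ρ),
          (((m : ℂ) - 1) / z - (m : ℂ) * z ^ (m - 1) / (z ^ m - 1)) ^ (m + 1))
      = ((m : ℂ) + 1) * (m : ℂ) * ((m : ℂ) - 1) ^ m := by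
  obtain ⟨h0, h1⟩ := hρ
  have hm0 : m ≠ 0 := by omega
  set a : ℂ := (m : ℂ) - 1 with ha
  let u : ℂ → ℂ := fun z => (m : ℂ) * z ^ m / (1 - z ^ m)
  let H : ℂ → ℂ := fun z => (m : ℂ) / (1 - z ^ m) *
    ∑ i ∈ Finset.range (m + 1), (a + u z) ^ i * a ^ (m + 1 - 1 - i)
  have hne : ∀ z ∈ Metric.closedBall (0 : ℂ) ρ, 1 - z ^ m ≠ 0 := by
    intro z hz h
    have hz' : ‖z‖ < 1 := lt_of_le_of_lt (by simpa using hz) h1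
    have h2 : ‖z‖ ^ m < 1 := pow_lt_one₀ (norm_nonneg z) hz' hm0
    rw [← norm_pow, ← sub_eq_zero.mp h] at h2
    simp at h2
  have hHd : ∀ z ∈ Metric.closedBall (0 : ℂ) ρ, DifferentiableAt ℂ H z := by
    intro z hz
    have h := hne z hz
    have hu : DifferentiableAt ℂ u z := by
      exact DifferentiableAt.fun_div (c := fun z : ℂ => (m : ℂ) * z ^ m)
        (d := fun z : ℂ => 1 - z ^ m) (by fun_prop) (by fun_prop) h
    apply DifferentiableAt.mul
    · exact DifferentiableAt.fun_div (c := fun _ : ℂ => (m : ℂ))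
        (d := fun z : ℂ => 1 - z ^ m) (by fun_prop) (by fun_prop) h
    · fun_prop
  have hHc : ContinuousOn H (Metric.closedBall 0 ρ) := fun z hz =>
    (hHd z hz).continuousAt.continuousWithinAt
  have hH0 : H 0 = ((m : ℂ) + 1) * (m : ℂ) * a ^ m := by
    have hs : ∑ i ∈ Finset.range (m + 1), (a + u 0) ^ i * a ^ (m + 1 - 1 - i)
        = ((m : ℂ) + 1) * a ^ m := by
      rw [Finset.sum_congr rfl (g := fun _ => a ^ m)]
      · simp
      · intro i hi
        have : i ≤ m := by simpa [Nat.lt_succ_iff] using hi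
        simp only [u, zero_pow hm0, mul_zero, zero_div, add_zero, ← pow_add]
        congr 1
        omega
    simp only [H, hs, zero_pow hm0]
    ring
  have hC := Complex.circleIntegral_sub_center_inv_smul_of_differentiable_on_off_countable h0
    Set.countable_empty hHc (fun z hz => hHd z (Metric.ball_subset_closedBall hz.1))
  have hZ : (∮ z in C(0, ρ), (z - 0 : ℂ) ^ (-((m : ℤ) + 1))) = 0 :=
    circleIntegral.integral_sub_zpow_of_ne (by omega) _ _ _
  have hsz : ∀ z ∈ Metric.sphere (0 : ℂ) ρ, z ≠ 0 := by
    rintro z hz rfl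
    simp at hz
    linarith
  have hcong : Set.EqOn (fun z : ℂ => (a / z - (m : ℂ) * z ^ (m - 1) / (z ^ m - 1)) ^ (m + 1))
      (fun z => a ^ (m + 1) * (z - 0) ^ (-((m : ℤ) + 1)) + (z - 0)⁻¹ • H z)
      (Metric.sphere 0 ρ) := by
    intro z hz
    have hz0 := hsz z hz
    have hw := hne z (Metric.sphere_subset_closedBall hz)
    have hw' : z ^ m - 1 ≠ 0 := by
      intro h
      apply hw
      linear_combination -h
    have hp : z ^ m = z ^ (m - 1) * z := by
      rw [← pow_succ]
      congr 1
      omega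
    have e1 : a / z - (m : ℂ) * z ^ (m - 1) / (z ^ m - 1) = (a + u z) / z := by
      simp only [u]
      have : (m : ℂ) * z ^ (m - 1) / (z ^ m - 1) = -((m : ℂ) * z ^ m / (1 - z ^ m) / z) := by
        rw [div_div, ← neg_div_neg_eq, ← neg_div, div_eq_div_iff (neg_ne_zero.mpr hw') (mul_ne_zero hw hz0)]
        linear_combination (-(m : ℂ) * (z ^ m - 1)) * (-1 : ℂ) * (-hp)
      rw [this]
      ring
    have e2 := (Commute.all (a + u z) a).geom_sum₂_mul (m + 1)
    have e3 : z ^ (-((m : ℤ) + 1)) = (z ^ (m + 1))⁻¹ := by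
      rw [zpow_neg]
      norm_cast
    have e4 : u z = z ^ m * ((m : ℂ) / (1 - z ^ m)) := by
      simp only [u]
      ring
    have e5 : (a + u z) ^ (m + 1) = a ^ (m + 1) + z ^ m * H z := by
      simp only [H]
      rw [add_sub_cancel_left] at e2
      linear_combination -e2 + (∑ i ∈ Finset.range (m + 1), (a + u z) ^ i * a ^ (m + 1 - 1 - i)) * e4
    simp only [sub_zero, smul_eq_mul]
    rw [e1, div_pow, e5, e3]
    field_simp
    ring
  rw [circleIntegral.integral_congr h0.le hcong, circleIntegral.integral_add,
    circleIntegral.integral_const_mul, hZ, hC, hH0]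
  · have := Complex.two_pi_I_ne_zero
    rw [mul_zero, zero_add, smul_eq_mul, inv_mul_cancel_left₀ this]
  · apply ContinuousOn.circleIntegrable h0.le
    intro z hz
    apply ContinuousAt.continuousWithinAt
    apply ContinuousAt.mul continuousAt_const
    apply ContinuousAt.zpow₀ (by fun_prop)
    left
    simpa using hsz z hz
  · apply ContinuousOn.circleIntegrable h0.le
    apply ContinuousOn.fun_smul
    · apply ContinuousOn.inv₀ (by fun_prop)
      intro z hz
      simpa using hsz z hz
    · exact hHc.mono Metric.sphere_subset_closedBall
end

section
/- For every real number a and every radius ρ with 0 < ρ < 2, the circle integral ∮_{|z+1|=ρ} (2ia)/(z²−1) dz = 2πa. In particular, if a ≠ 0, then Re ∮_{|z+1|=ρ} (2ia)/(z²−1) dz = 2πa ≠ 0, so the vertical period condition Re ∮ dh = 0 fails for the 1-form (2ia)/(z²−1) dz along a loop around z = −1 (hence the Costa minimal surface data admits no companion maxface). -/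
/-- The circle integral of `2ia/(z²−1)` around `z = −1` equals `2πa`; in particular,
for `a ≠ 0` its real part is nonzero, so the vertical period condition
`Re ∮ dh = 0` fails for the would-be maxface companion of the Costa surface. -/
theorem costa_companion_period_obstruction (a ρ : ℝ) (hρ0 : 0 < ρ) (hρ2 : ρ < 2) :
    (∮ z in C(-1, ρ), (2 * Complex.I * (a : ℂ)) / (z ^ 2 - 1))
        = ((2 * Real.pi * a : ℝ) : ℂ)
    ∧ (a ≠ 0 →
        (∮ z in C(-1, ρ), (2 * Complex.I * (a : ℂ)) / (z ^ 2 - 1)).re ≠ 0) := by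
  have key : (∮ z in C(-1, ρ), (2 * Complex.I * (a : ℂ)) / (z ^ 2 - 1))
      = ((2 * Real.pi * a : ℝ) : ℂ) := by
    have hd : DifferentiableOn ℂ (fun z : ℂ => (2 * Complex.I * (a : ℂ)) / (z - 1))
        (Metric.closedBall (-1) ρ) := by
      intro z hz
      have hne : z - 1 ≠ 0 := by
        intro h
        have hz1 : z = 1 := sub_eq_zero.mp h
        rw [hz1, Metric.mem_closedBall, dist_eq_norm] at hz
        norm_num at hz
        linarith
      have h1 : DifferentiableAt ℂ (fun z : ℂ => z - 1) z := by fun_prop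
      have h2 : DifferentiableAt ℂ (fun _ : ℂ => 2 * Complex.I * (a : ℂ)) z := by fun_prop
      exact (h2.fun_div h1 hne).differentiableWithinAt
    have h := hd.circleIntegral_sub_inv_smul (Metric.mem_ball_self hρ0)
    have hf : (fun z : ℂ => (2 * Complex.I * (a : ℂ)) / (z ^ 2 - 1))
        = fun z : ℂ => (z - (-1))⁻¹ • ((2 * Complex.I * (a : ℂ)) / (z - 1)) := by
      funext z
      have : z ^ 2 - 1 = (z - (-1)) * (z - 1) := by ring
      rw [this, smul_eq_mul, div_eq_mul_inv, div_eq_mul_inv, mul_inv]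
      ring
    rw [hf, h, smul_eq_mul]
    push_cast
    ring_nf
    rw [Complex.I_sq]
    ring
  refine ⟨key, fun ha => ?_⟩
  rw [key, Complex.ofReal_re]
  exact mul_ne_zero (mul_ne_zero two_ne_zero Real.pi_ne_zero) ha
end
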